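/- arXiv:1705.09177 — 2 statements merged into one kernel-verified Lean document; each statement's English description precedes it below -/
import Mathlib

section
/- A finite simple graph G is (1,1)-well-covered if and only if there exist a nonnegative integer k and a partition of the vertex set of G into an independent set S and a clique K with |K| = k such that either (a) every vertex of K has degree k−1 in G and every vertex of S has degree 0 in G, or (b) k ≥ 1, every vertex of K has degree k in G, and the sum of the degrees in G of the vertices of S equals k. -/
/-- A set of vertices is independent if no two of its vertices are adjacent. -/
def SimpleGraph.IsIndep {V : Type*} (G : SimpleGraph V) (s : Set V) : Prop :=
  s.Pairwise fun u v => ¬ G.Adj u v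

/-- A maximal independent set: independent and not properly contained in another
independent set. -/
def SimpleGraph.IsMaxIndep {V : Type*} (G : SimpleGraph V) (s : Set V) : Prop :=
  G.IsIndep s ∧ ∀ t : Set V, G.IsIndep t → s ⊆ t → s = t

/-- A graph is well-covered if all its maximal independent sets have the same
cardinality. -/
def SimpleGraph.WellCovered {V : Type*} (G : SimpleGraph V) : Prop :=
  ∀ s t : Set V, G.IsMaxIndep s → G.IsMaxIndep t → s.ncard = t.ncard

/-- An `(r, ℓ)`-graph: the vertex set can be partitioned into `r` independent sets
and `ℓ` cliques (any of which may be empty): every vertex belongs to exactly one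
of the parts. -/
def SimpleGraph.IsRLGraph {V : Type*} (G : SimpleGraph V) (r ℓ : ℕ) : Prop :=
  ∃ (S : Fin r → Set V) (K : Fin ℓ → Set V),
    (∀ i, G.IsIndep (S i)) ∧ (∀ j, G.IsClique (K j)) ∧
    ∀ v : V, ∃! p : Fin r ⊕ Fin ℓ, v ∈ Sum.elim S K p

namespace SimpleGraph

/-- For a vertex `x` outside `S`, replacing the neighbors of `x` in `S` by `x` changes the
cardinality of `S` by one minus the number of these neighbors. -/
theorem ncard_insert_add {V : Type*} [DecidableEq V] {G : SimpleGraph V} [DecidableRel G.Adj]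
    {S : Finset V} {x : V} (hxS : x ∉ S) :
    ((insert x (S.filter fun v => ¬ G.Adj x v) : Finset V) : Set V).ncard
      + (S.filter (G.Adj x)).card = S.card + 1 := by
  rw [Set.ncard_coe_finset, Finset.card_insert_of_notMem (by simp [hxS])]
  have := Finset.card_filter_add_card_filter_not (s := S) (G.Adj x)
  omega

theorem isMaxIndep_of_forall_exists_adj {V : Type*} [Fintype V] [DecidableEq V] {G : SimpleGraph V}
    {S K : Finset V} (hu : S ∪ K = Finset.univ) (hS : G.IsIndep (S : Set V))
    (h : ∀ x ∈ K, ∃ v ∈ S, G.Adj x v) : G.IsMaxIndep (S : Set V) := by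
  refine ⟨hS, fun t ht hst => hst.antisymm fun y hyt => ?_⟩
  by_contra hyS
  have hy : y ∈ S ∪ K := hu ▸ Finset.mem_univ y
  obtain ⟨v, hv, hyv⟩ := h y ((Finset.mem_union.1 hy).resolve_left hyS)
  exact ht hyt (hst hv) hyv.ne hyv

section Split

variable {V : Type*} [Fintype V] [DecidableEq V] {G : SimpleGraph V} [DecidableRel G.Adj]
  {S K : Finset V}

/-- In a split graph, the neighbors of a clique vertex are the other clique vertices together with
its neighbors on the independent side. -/
theorem degree_of_mem_clique (hd : Disjoint S K) (hu : S ∪ K = Finset.univ)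
    (hK : G.IsClique (K : Set V)) {x : V} (hx : x ∈ K) :
    G.degree x = K.card - 1 + (S.filter (G.Adj x)).card := by
  have h : G.neighborFinset x = K.erase x ∪ S.filter (G.Adj x) := by
    ext y
    have hy : y ∈ S ∪ K := hu ▸ Finset.mem_univ y
    simp only [mem_neighborFinset, Finset.mem_union, Finset.mem_erase, Finset.mem_filter] at hy ⊢
    constructor
    · intro hxy
      have := hxy.ne'
      tauto
    · rintro (⟨hne, hyK⟩ | h)
      · exact hK hx hyK hne.symm
      · exact h.2
  have hdis : Disjoint (K.erase x) (S.filter (G.Adj x)) :=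
    (hd.mono (Finset.filter_subset _ _) (Finset.erase_subset _ _)).symm
  rw [← card_neighborFinset_eq_degree, h, Finset.card_union_of_disjoint hdis,
    Finset.card_erase_of_mem hx]

theorem degree_of_mem_indep (hu : S ∪ K = Finset.univ)
    (hS : G.IsIndep (S : Set V)) {v : V} (hv : v ∈ S) :
    G.degree v = (K.filter (G.Adj v)).card := by
  rw [← card_neighborFinset_eq_degree]
  congr 1
  ext y
  have hy : y ∈ S ∪ K := hu ▸ Finset.mem_univ y
  simp only [mem_neighborFinset, Finset.mem_union, Finset.mem_filter] at hy ⊢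
  refine ⟨fun h => ⟨hy.resolve_left fun hyS => hS hv hyS h.ne h, h⟩, fun h => h.2⟩

/-- Double counting of the edges between the two sides of a split graph. -/
theorem sum_degree_indep_eq (hu : S ∪ K = Finset.univ) (hS : G.IsIndep (S : Set V)) :
    ∑ v ∈ S, G.degree v = ∑ x ∈ K, (S.filter (G.Adj x)).card := by
  rw [Finset.sum_congr rfl fun v hv => degree_of_mem_indep hu hS hv]
  have h := Finset.sum_card_bipartiteAbove_eq_sum_card_bipartiteBelow (s := S) (t := K) G.Adj
  simpa only [Finset.bipartiteAbove, Finset.bipartiteBelow, G.adj_comm] using h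

theorem isMaxIndep_insert (hu : S ∪ K = Finset.univ) (hS : G.IsIndep (S : Set V))
    (hK : G.IsClique (K : Set V)) {x : V} (hx : x ∈ K) :
    G.IsMaxIndep (insert x (S.filter fun v => ¬ G.Adj x v) : Finset V) := by
  refine ⟨?_, fun t ht hst => hst.antisymm fun y hyt => ?_⟩
  · intro a ha b hb hab h
    simp only [Finset.coe_insert, Finset.coe_filter, Set.mem_insert_iff, Set.mem_ofPred_eq] at ha hb
    rcases ha with rfl | ha <;> rcases hb with rfl | hb
    · exact hab rfl
    · exact hb.2 h
    · exact ha.2 h.symm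
    · exact hS ha.1 hb.1 hab h
  · have hxt : x ∈ t := hst (by simp)
    by_cases hyx : y = x
    · simp [hyx]
    have hn : ¬ G.Adj x y := ht hxt hyt (Ne.symm hyx)
    have hy : y ∈ S ∪ K := hu ▸ Finset.mem_univ y
    rcases Finset.mem_union.1 hy with hy | hy
    · simp [hy, hn]
    · exact (hn (hK hx hy (Ne.symm hyx))).elim

/-- Classification of the maximal independent sets of a split graph. -/
theorem IsMaxIndep.eq_insert_or_eq (hu : S ∪ K = Finset.univ) (hS : G.IsIndep (S : Set V))
    (hK : G.IsClique (K : Set V)) {t : Set V} (ht : G.IsMaxIndep t) :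
    (∃ x ∈ K, t = (insert x (S.filter fun v => ¬ G.Adj x v) : Finset V)) ∨ t = S := by
  by_cases h : ∃ x ∈ K, x ∈ t
  · obtain ⟨x, hx, hxt⟩ := h
    refine Or.inl ⟨x, hx, ht.2 _ (isMaxIndep_insert hu hS hK hx).1 fun y hyt => ?_⟩
    by_cases hyx : y = x
    · simp [hyx]
    have hn : ¬ G.Adj x y := ht.1 hxt hyt (Ne.symm hyx)
    have hy : y ∈ S ∪ K := hu ▸ Finset.mem_univ y
    rcases Finset.mem_union.1 hy with hy | hy
    · simp [hy, hn]
    · exact (hn (hK hx hy (Ne.symm hyx))).elim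
  · push Not at h
    refine Or.inr (ht.2 _ hS fun y hyt => ?_)
    have hy : y ∈ S ∪ K := hu ▸ Finset.mem_univ y
    exact (Finset.mem_union.1 hy).resolve_right fun hyK => h y hyK hyt

/-- A split graph is well-covered iff either no edge joins the two sides, or every clique vertex
has exactly one neighbor on the independent side. -/
theorem wellCovered_iff_of_split (hd : Disjoint S K) (hu : S ∪ K = Finset.univ)
    (hS : G.IsIndep (S : Set V)) (hK : G.IsClique (K : Set V)) :
    G.WellCovered ↔ (∀ x ∈ K, (S.filter (G.Adj x)).card = 0) ∨
      (∀ x ∈ K, (S.filter (G.Adj x)).card = 1) := by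
  constructor
  · intro hw
    by_cases h : ∀ x ∈ K, ∃ v ∈ S, G.Adj x v
    · refine Or.inr fun x hx => ?_
      have h1 := hw _ _ (isMaxIndep_insert hu hS hK hx) (isMaxIndep_of_forall_exists_adj hu hS h)
      have h2 := ncard_insert_add (G := G) (Finset.disjoint_right.1 hd hx)
      rw [Set.ncard_coe_finset S] at h1
      omega
    · push Not at h
      obtain ⟨x, hx, hxS⟩ := h
      have h0 : (S.filter (G.Adj x)).card = 0 := by
        rw [Finset.card_eq_zero, Finset.filter_eq_empty_iff]
        exact fun v hv => hxS v hv
      refine Or.inl fun y hy => ?_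
      have h1 := hw _ _ (isMaxIndep_insert hu hS hK hx) (isMaxIndep_insert hu hS hK hy)
      have h2 := ncard_insert_add (G := G) (Finset.disjoint_right.1 hd hx)
      have h3 := ncard_insert_add (G := G) (Finset.disjoint_right.1 hd hy)
      omega
  · rintro (h | h)
    · have key : ∀ t, G.IsMaxIndep t → t.ncard = S.card + if K.Nonempty then 1 else 0 := by
        intro t ht
        have hins : ∀ x ∈ K, t = (insert x (S.filter fun v => ¬ G.Adj x v) : Finset V) →
            t.ncard = S.card + if K.Nonempty then 1 else 0 := by
          intro x hx e
          have h2 := ncard_insert_add (G := G) (Finset.disjoint_right.1 hd hx)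
          rw [if_pos ⟨x, hx⟩, e]
          have := h x hx
          omega
        rcases ht.eq_insert_or_eq hu hS hK with ⟨x, hx, e⟩ | e
        · exact hins x hx e
        · by_cases hne : K.Nonempty
          · obtain ⟨x, hx⟩ := hne
            refine hins x hx (ht.2 _ (isMaxIndep_insert hu hS hK hx).1 ?_)
            intro v hv
            rw [e] at hv
            have h0 := h x hx
            rw [Finset.card_eq_zero, Finset.filter_eq_empty_iff] at h0
            have hv' : v ∈ S := hv
            simp [hv', h0 hv']
          · rw [if_neg hne, e, Set.ncard_coe_finset, add_zero]
      exact fun s t hs ht => (key s hs).trans (key t ht).symm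
    · have key : ∀ t, G.IsMaxIndep t → t.ncard = S.card := by
        intro t ht
        rcases ht.eq_insert_or_eq hu hS hK with ⟨x, hx, e⟩ | e
        · have h2 := ncard_insert_add (G := G) (Finset.disjoint_right.1 hd hx)
          have := h x hx
          rw [e]
          omega
        · rw [e, Set.ncard_coe_finset]
      exact fun s t hs ht => (key s hs).trans (key t ht).symm

end Split

theorem isRLGraph_one_one_iff {V : Type*} [Fintype V] [DecidableEq V] (G : SimpleGraph V) :
    G.IsRLGraph 1 1 ↔ ∃ S K : Finset V, Disjoint S K ∧ S ∪ K = Finset.univ ∧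
      G.IsIndep (S : Set V) ∧ G.IsClique (K : Set V) := by
  classical
  constructor
  · rintro ⟨S, K, hS, hK, h⟩
    refine ⟨(S 0).toFinset, (K 0).toFinset, ?_, ?_, by simpa using hS 0, by simpa using hK 0⟩
    · rw [Finset.disjoint_left]
      intro v hv hv'
      have := (h v).unique (y₁ := Sum.inl 0) (y₂ := Sum.inr 0) (by simpa using hv)
        (by simpa using hv')
      cases this
    · ext v
      obtain ⟨p, hp, -⟩ := h v
      rcases p with i | i
      · obtain rfl := Subsingleton.elim i 0
        have : v ∈ S 0 := hp
        simp [this]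
      · obtain rfl := Subsingleton.elim i 0
        have : v ∈ K 0 := hp
        simp [this]
  · rintro ⟨S, K, hd, hu, hS, hK⟩
    refine ⟨fun _ => S, fun _ => K, fun _ => hS, fun _ => hK, fun v => ?_⟩
    have hv : v ∈ S ∪ K := hu ▸ Finset.mem_univ v
    have hn : v ∈ S → v ∉ K := fun h => Finset.disjoint_left.1 hd h
    rcases Finset.mem_union.1 hv with hv | hv
    · refine ⟨Sum.inl 0, hv, ?_⟩
      rintro (i | i) hi
      · rw [Subsingleton.elim i 0]
      · exact (hn hv hi).elim
    · refine ⟨Sum.inr 0, hv, ?_⟩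
      rintro (i | i) hi
      · exact (hn hi hv).elim
      · rw [Subsingleton.elim i 0]

end SimpleGraph

open SimpleGraph

theorem stmt_5 {V : Type*} [Fintype V] [DecidableEq V] (G : SimpleGraph V)
    [DecidableRel G.Adj] :
    (G.IsRLGraph 1 1 ∧ G.WellCovered) ↔
      ∃ (k : ℕ) (S K : Finset V), Disjoint S K ∧ S ∪ K = Finset.univ ∧
        G.IsIndep (S : Set V) ∧ G.IsClique (K : Set V) ∧ K.card = k ∧
        (((∀ x ∈ K, G.degree x = k - 1) ∧ ∀ v ∈ S, G.degree v = 0) ∨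
          (1 ≤ k ∧ (∀ x ∈ K, G.degree x = k) ∧ ∑ v ∈ S, G.degree v = k)) := by
  rw [isRLGraph_one_one_iff]
  constructor
  · rintro ⟨⟨S, K, hd, hu, hS, hK⟩, hw⟩
    refine ⟨K.card, S, K, hd, hu, hS, hK, rfl, ?_⟩
    have hsum := sum_degree_indep_eq hu hS
    have hdeg := fun x (hx : x ∈ K) => degree_of_mem_clique hd hu hK hx
    have hzero : (∀ x ∈ K, (S.filter (G.Adj x)).card = 0) →
        ((∀ x ∈ K, G.degree x = K.card - 1) ∧ ∀ v ∈ S, G.degree v = 0) := by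
      intro h
      refine ⟨fun x hx => by rw [hdeg x hx, h x hx, add_zero], ?_⟩
      rw [Finset.sum_eq_zero h] at hsum
      exact Finset.sum_eq_zero_iff.1 hsum
    rcases (wellCovered_iff_of_split hd hu hS hK).1 hw with h | h
    · exact Or.inl (hzero h)
    · rcases K.eq_empty_or_nonempty with he | hne
      · exact Or.inl (hzero (by simp [he]))
      · have hpos := hne.card_pos
        refine Or.inr ⟨hpos, fun x hx => ?_, ?_⟩
        · rw [hdeg x hx, h x hx]
          omega
        · rw [hsum, Finset.sum_congr rfl h]
          simp
  · rintro ⟨k, S, K, hd, hu, hS, hK, rfl, h⟩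
    refine ⟨⟨S, K, hd, hu, hS, hK⟩, (wellCovered_iff_of_split hd hu hS hK).2 ?_⟩
    refine h.imp (fun h x hx => ?_) fun h x hx => ?_
    · have h1 := h.1 x hx
      have h2 := degree_of_mem_clique hd hu hK hx
      omega
    · have h1 := h.2.1 x hx
      have h2 := degree_of_mem_clique hd hu hK hx
      have h3 := h.1
      omega
end

section
/- Let G be a finite simple graph, let r, ℓ ≥ 0 be integers, and let p ≥ ℓ+1. Let H be the join of G with an edgeless graph on p vertices (every new vertex is adjacent in H to every vertex of G). Then H is an (r+1, ℓ)-graph if and only if G is an (r, ℓ)-graph. -/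
/-- A graph is an `(r, ℓ)`-graph iff its vertices can be labelled by the `r + ℓ` parts so that
vertices sharing a label of the first kind are non-adjacent and distinct vertices sharing a label
of the second kind are adjacent. -/
theorem SimpleGraph.isRLGraph_iff_exists_labelling {V : Type*} (G : SimpleGraph V) (r ℓ : ℕ) :
    G.IsRLGraph r ℓ ↔ ∃ f : V → Fin r ⊕ Fin ℓ,
      (∀ u v i, f u = Sum.inl i → f v = Sum.inl i → ¬ G.Adj u v) ∧
      (∀ u v j, f u = Sum.inr j → f v = Sum.inr j → u ≠ v → G.Adj u v) := by
  constructor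
  · rintro ⟨S, K, hS, hK, hpart⟩
    choose f hf _ using hpart
    refine ⟨f, fun u v i hu hv huv => ?_, fun u v j hu hv huv => ?_⟩
    · have hmu := hf u
      have hmv := hf v
      simp only [hu, hv, Sum.elim_inl] at hmu hmv
      exact hS i hmu hmv huv.ne huv
    · have hmu := hf u
      have hmv := hf v
      simp only [hu, hv, Sum.elim_inr] at hmu hmv
      exact hK j hmu hmv huv
  · rintro ⟨f, hS, hK⟩
    refine ⟨fun i => {v | f v = Sum.inl i}, fun j => {v | f v = Sum.inr j},
      fun i u hu v hv _ => hS u v i hu hv, fun j u hu v hv huv => hK u v j hu hv huv,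
      fun v => ⟨f v, ?_, ?_⟩⟩
    · rcases h : f v with i | j <;> simpa using h
    · rintro (i | j) h <;> exact Eq.symm h

theorem stmt_12 {V : Type*} [Fintype V] (G : SimpleGraph V) (r ℓ p : ℕ)
    (hp : ℓ + 1 ≤ p) (H : SimpleGraph (V ⊕ Fin p))
    (hGG : ∀ a b : V, H.Adj (Sum.inl a) (Sum.inl b) ↔ G.Adj a b)
    (hZZ : ∀ a b : Fin p, ¬ H.Adj (Sum.inr a) (Sum.inr b))
    (hjoin : ∀ (a : V) (b : Fin p), H.Adj (Sum.inl a) (Sum.inr b)) :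
    H.IsRLGraph (r + 1) ℓ ↔ G.IsRLGraph r ℓ := by
  rw [H.isRLGraph_iff_exists_labelling, G.isRLGraph_iff_exists_labelling]
  constructor
  · rintro ⟨f, hS, hK⟩
    obtain ⟨b, i, hb⟩ : ∃ b i, f (Sum.inr b) = Sum.inl i := by
      by_contra! hno
      have hright : ∀ b : Fin p, ∃ j, f (Sum.inr b) = Sum.inr j := fun b => by
        rcases h : f (Sum.inr b) with i | j
        · exact absurd h (hno b i)
        · exact ⟨j, rfl⟩
      choose k hk using hright
      obtain ⟨a, b, hab, hkab⟩ := Fintype.exists_ne_map_eq_of_card_lt k (by simpa using hp)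
      exact hZZ a b (hK _ _ (k a) (hk a) (hkab ▸ hk b) (by simpa using hab))
    have hlift : ∀ v : V, ∃ q : Fin r ⊕ Fin ℓ,
        f (Sum.inl v) = Sum.map i.succAbove id q := fun v => by
      rcases h : f (Sum.inl v) with j | j
      · have hj : j ≠ i := by
          rintro rfl
          exact hS _ _ _ h hb (hjoin v b)
        obtain ⟨m, rfl⟩ := Fin.exists_succAbove_eq hj
        exact ⟨Sum.inl m, rfl⟩
      · exact ⟨Sum.inr j, rfl⟩
    choose g hg using hlift
    refine ⟨g, fun u v m hu hv huv => ?_, fun u v j hu hv huv => ?_⟩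
    · exact hS _ _ (i.succAbove m) (by simp [hg, hu]) (by simp [hg, hv]) ((hGG u v).2 huv)
    · exact (hGG u v).1 (hK _ _ j (by simp [hg, hu]) (by simp [hg, hv]) (by simpa using huv))
  · rintro ⟨f, hS, hK⟩
    refine ⟨Sum.elim (fun v => Sum.map Fin.succ id (f v)) fun _ => Sum.inl 0, ?_, ?_⟩
    · rintro (u | a) (v | b) i hu hv
      · rw [hGG]
        rcases hfu : f u with m | m <;> rcases hfv : f v with n | n <;> simp [hfu, hfv] at hu hv
        obtain rfl : m = n := Fin.succ_injective _ (hu.trans hv.symm)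
        exact hS u v m hfu hfv
      · rcases hfu : f u with m | m <;> simp [hfu] at hu hv
        exact absurd (hu.trans hv.symm) (Fin.succ_ne_zero m)
      · rcases hfv : f v with m | m <;> simp [hfv] at hu hv
        exact absurd (hv.trans hu.symm) (Fin.succ_ne_zero m)
      · exact hZZ a b
    · rintro (u | a) (v | b) j hu hv huv
      · rcases hfu : f u with m | m <;> rcases hfv : f v with n | n <;> simp [hfu, hfv] at hu hv
        subst hu hv
        exact (hGG u v).2 (hK u v _ hfu hfv (by simpa using huv))
      all_goals simp at hu hv
end
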